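/- arXiv:1602.03424 — 2 statements merged into one kernel-verified Lean document; each statement's English description precedes it below -/
import Mathlib

section
/- Let G = (V, E) be a connected graph and B ⊆ V a finite set whose removal disconnects G into a finite graph F and a second graph, and let S be F together with the vertices of B as sinks. Let η be a configuration such that repeatedly adding η and stabilizing on G always topples the vertices of B equally. Then for every vertex v of F, the number of grains on v is eventually periodic with respect to the number of times η has been added and stabilized; i.e., the sequence of restricted configurations G|_F under repeated addition-and-stabilization of η is eventually periodic. -/
open Classical

namespace ASM

variable {V : Type*}

/-- The degree of a vertex. -/
noncomputable def deg (G : SimpleGraph V) (v : V) : ℕ := (G.neighborSet v).ncard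

/-- The result of toppling the vertex `v`: `v` loses `deg v` grains and each
neighbor of `v` receives one grain. -/
noncomputable def toppleAt (G : SimpleGraph V) (η : V → ℕ) (v : V) : V → ℕ :=
  fun u => if u = v then η v - deg G v else η u + (if G.Adj v u then 1 else 0)

/-- `Topples G S η l η'` means that starting from the configuration `η`, the vertices in
the list `l` may be legally toppled in order (each toppled vertex is not a sink and holds
at least `deg` many grains when toppled), resulting in the configuration `η'`.
`S` is the set of sink vertices. -/
inductive Topples (G : SimpleGraph V) (S : Set V) : (V → ℕ) → List V → (V → ℕ) → Prop
  | nil (η : V → ℕ) : Topples G S η [] η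
  | cons {η η' : V → ℕ} {l : List V} (v : V) (hv : v ∉ S) (hge : deg G v ≤ η v)
      (ht : Topples G S (toppleAt G η v) l η') : Topples G S η (v :: l) η'

/-- A configuration is stable if every non-sink vertex has fewer grains than its degree. -/
def Stable (G : SimpleGraph V) (S : Set V) (η : V → ℕ) : Prop :=
  ∀ v, v ∉ S → η v < deg G v

/-- `η` stabilizes to `η'`: there is a legal toppling sequence from `η` to the
stable configuration `η'`. -/
def StabilizesTo (G : SimpleGraph V) (S : Set V) (η η' : V → ℕ) : Prop :=
  ∃ l : List V, Topples G S η l η' ∧ Stable G S η'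

/-- A configuration `η` is recurrent if it is stable and, for every configuration `σ`,
there is a configuration `τ` such that `σ + τ` stabilizes to `η` (equality being
required away from the sinks, where grains simply accumulate). -/
def Recurrent (G : SimpleGraph V) (S : Set V) (η : V → ℕ) : Prop :=
  Stable G S η ∧
    ∀ σ : V → ℕ, ∃ τ η' : V → ℕ, StabilizesTo G S (σ + τ) η' ∧ ∀ v, v ∉ S → η' v = η v

/-- `idf G S v` is the number of edges joining `v` to sink vertices. -/
noncomputable def idf (G : SimpleGraph V) (S : Set V) (v : V) : ℕ :=
  (G.neighborSet v ∩ S).ncard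

end ASM

open ASM

namespace ASM

variable {V : Type*}

lemma deg_eq (G : SimpleGraph V) [G.LocallyFinite] (v : V) : deg G v = G.degree v := by
  unfold deg
  rw [Set.ncard_eq_toFinset_card', ← SimpleGraph.card_neighborFinset_eq_degree]
  rfl

lemma topples_eq (G : SimpleGraph V) [G.LocallyFinite] {x y : V → ℕ} {l : List V}
    (h : Topples G ∅ x l y) (v : V) :
    (y v : ℤ) = x v - G.degree v * (l.count v : ℤ)
      + ∑ w ∈ G.neighborFinset v, (l.count w : ℤ) := by
  induction h with
  | nil => simp
  | @cons x y l a ha hge ht ih =>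
    rw [ih]
    have hc : ∀ w, ((a :: l).count w : ℤ) = l.count w + if w = a then 1 else 0 := by
      intro w
      rw [List.count_cons]
      by_cases h : w = a
      · subst h; simp
      · have : ¬ a = w := fun e => h e.symm
        simp [h, this]
    simp only [hc, Finset.sum_add_distrib, Finset.sum_ite_eq', SimpleGraph.mem_neighborFinset]
    rw [deg_eq] at hge
    unfold toppleAt
    by_cases h : v = a
    · subst h
      simp only [if_true, deg_eq, SimpleGraph.irrefl, if_false]
      push_cast [hge]
      ring
    · simp only [h, if_false, G.adj_comm a v]
      push_cast
      ring

/-- no forbidden subconfiguration inside `T` -/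
def Inv (G : SimpleGraph V) (T : Set V) (x : V → ℕ) : Prop :=
  ∀ A : Finset V, A.Nonempty → (∀ v ∈ A, v ∈ T) →
    ∃ v ∈ A, (A.filter (fun w => G.Adj v w)).card ≤ x v

lemma inv_topples (G : SimpleGraph V) {x y : V → ℕ} {l : List V}
    (h : Topples G ∅ x l y) : ∀ T, Inv G T x → Inv G (T ∪ {v | v ∈ l}) y := by
  induction h with
  | nil => intro T hT; simpa using hT
  | @cons x y l a ha hge ht ih =>
    intro T hT
    have key : Inv G (T ∪ {a}) (toppleAt G x a) := by
      intro A hA hAT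
      by_cases haA : a ∈ A
      · by_cases hne : (A.erase a).Nonempty
        · obtain ⟨v, hv, hle⟩ := hT (A.erase a) hne (by
            intro v hv
            rw [Finset.mem_erase] at hv
            rcases hAT v hv.2 with h | h
            · exact h
            · exact absurd h hv.1)
          rw [Finset.mem_erase] at hv
          refine ⟨v, hv.2, ?_⟩
          unfold toppleAt
          rw [if_neg hv.1]
          have h2 : A = insert a (A.erase a) := (Finset.insert_erase haA).symm
          rw [h2, Finset.filter_insert, G.adj_comm a v]
          split_ifs
          · exact (Finset.card_insert_le _ _).trans (by omega)
          · omega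
        · refine ⟨a, haA, ?_⟩
          have h2 : A.filter (fun w => G.Adj a w) = ∅ := by
            rw [Finset.filter_eq_empty_iff]
            intro w hw hadj
            exact hne ⟨w, Finset.mem_erase.2 ⟨hadj.ne', hw⟩⟩
          rw [h2]; simp
      · obtain ⟨v, hv, hle⟩ := hT A hA (by
          intro v hv
          rcases hAT v hv with h | h
          · exact h
          · have : v = a := h
            subst this; exact absurd hv haA)
        refine ⟨v, hv, hle.trans ?_⟩
        unfold toppleAt
        rw [if_neg (by rintro rfl; exact haA hv)]
        omega
    have h3 := ih _ key
    have h4 : T ∪ {v | v ∈ a :: l} = T ∪ {a} ∪ {v | v ∈ l} := by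
      ext v; simp; tauto
    rw [h4]; exact h3

lemma inv_mono (G : SimpleGraph V) {T : Set V} {x y : V → ℕ} (h : Inv G T x)
    (hxy : ∀ v, x v ≤ y v) : Inv G T y := by
  intro A h1 h2
  obtain ⟨v, hv, hle⟩ := h A h1 h2
  exact ⟨v, hv, hle.trans (hxy v)⟩

lemma nonpos_aux (G : SimpleGraph V) [G.LocallyFinite] {F B : Set V} (hF : F.Finite)
    (hnb : ∀ v ∈ F, ∀ w, G.Adj v w → w ∈ F ∨ w ∈ B) {x y : V → ℕ}
    (hx : ∀ v ∈ F, x v < G.degree v) (hy : Inv G F y) (z : V → ℤ) (hz : ∀ b ∈ B, z b = 0)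
    (heq : ∀ v ∈ F, (y v : ℤ) = x v - G.degree v * z v + ∑ w ∈ G.neighborFinset v, z w) :
    ∀ v ∈ F, z v ≤ 0 := by
  by_contra! hcon
  obtain ⟨v0, hv0, hpos⟩ := hcon
  obtain ⟨m, hm, hmax⟩ := Set.exists_max_image F z hF ⟨v0, hv0⟩
  have hmpos : 0 < z m := hpos.trans_le (hmax v0 hv0)
  obtain ⟨v, hv, hle⟩ := hy (hF.toFinset.filter (fun v => z v = z m))
    ⟨m, by simp [hm]⟩ (by intro v hv; simp at hv; exact hv.1)
  simp only [Finset.mem_filter, Set.Finite.mem_toFinset] at hv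
  have e := heq v hv.1
  have hd := hx v hv.1
  have hsum : ∑ w ∈ G.neighborFinset v, z w ≤
      ∑ w ∈ G.neighborFinset v, ((z m - 1) + if (w ∈ F ∧ z w = z m) then 1 else 0) := by
    apply Finset.sum_le_sum
    intro w hw
    rw [SimpleGraph.mem_neighborFinset] at hw
    rcases hnb v hv.1 w hw with h | h
    · have := hmax w h
      by_cases h' : z w = z m
      · simp [h, h']
      · simp only [h, h', and_false, if_false]; omega
    · rw [hz w h]; split_ifs <;> omega
  rw [Finset.sum_add_distrib, Finset.sum_const, Finset.sum_boole,
    SimpleGraph.card_neighborFinset_eq_degree] at hsum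
  have hset : (G.neighborFinset v).filter (fun w => w ∈ F ∧ z w = z m)
      = (hF.toFinset.filter (fun v => z v = z m)).filter (fun w => G.Adj v w) := by
    ext w; simp; tauto
  rw [hset, nsmul_eq_mul] at hsum
  rw [hv.2] at e
  have : (G.degree v : ℤ) * (z m - 1) = G.degree v * z m - G.degree v := by ring
  omega

end ASM

/-- Let `G = (V, E)` be a connected graph and `B ⊆ V` a finite set whose
removal disconnects `G` into a finite graph `F` and a second (nonempty) graph `W`.  Let
`η` be a configuration supported on `F` such that repeatedly adding `η` and stabilizing
on `G` (starting from an initial configuration `ηG`) is always possible and always topples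
the vertices of `B` equally.  Then the restriction to `F` of the resulting sequence of
stabilized configurations is eventually periodic: there are `N` and `p > 0` such that for
all `i ≥ N` the configurations at steps `i` and `i + p` agree on every vertex of `F`. -/
theorem sandpile_eventual_periodicity
    {V : Type*} (G : SimpleGraph V) (hG : G.Connected)
    (B F W : Set V) (hBfin : B.Finite) (hFfin : F.Finite)
    (hFne : F.Nonempty) (hWne : W.Nonempty)
    (hcover : F ∪ B ∪ W = Set.univ)
    (hFB : Disjoint F B) (hFW : Disjoint F W) (hBW : Disjoint B W)
    (hsep : ∀ u ∈ F, ∀ w ∈ W, ¬ G.Adj u w)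
    (η : V → ℕ) (hsupp : ∀ v, v ∉ F → η v = 0)
    (ηG : V → ℕ) (σ : ℕ → (V → ℕ)) (hσ0 : σ 0 = ηG)
    (hstep : ∀ i : ℕ, ∃ l : List V, Topples G ∅ (σ i + η) l (σ (i + 1)) ∧
        Stable G ∅ (σ (i + 1)) ∧ ∃ c : ℕ, ∀ b ∈ B, l.count b = c) :
    ∃ N p : ℕ, 0 < p ∧ ∀ i : ℕ, N ≤ i → ∀ v ∈ F, σ (i + p) v = σ i v := by
  have hdegpos : ∀ v, 0 < deg G v := by
    intro v
    obtain ⟨l, -, h, -⟩ := hstep 0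
    exact (Nat.zero_le _).trans_lt (h v (by simp))
  letI : G.LocallyFinite := fun v => (Set.finite_of_ncard_pos (hdegpos v)).fintype
  choose l hl hst c hc using hstep
  have hst' : ∀ n, 1 ≤ n → ∀ v, σ n v < G.degree v := by
    intro n hn v
    obtain ⟨k, rfl⟩ := Nat.exists_eq_add_of_le' hn
    rw [← deg_eq]; exact hst k v (by simp)
  have hnb : ∀ v ∈ F, ∀ w, G.Adj v w → w ∈ F ∨ w ∈ B := by
    intro v hv w hw
    have : w ∈ F ∪ B ∪ W := by rw [hcover]; trivial
    rcases this with h | h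
    · exact h
    · exact absurd hw (hsep v hv w h)
  let u : ℕ → V → ℕ := fun n v => ∑ i ∈ Finset.range n, (l i).count v
  have hu0 : ∀ v, u 0 v = 0 := fun v => by simp [u]
  have hus : ∀ n v, u (n + 1) v = u n v + (l n).count v := fun n v => by
    simp [u, Finset.sum_range_succ]
  have humono : ∀ v, Monotone (fun n => u n v) := fun v =>
    monotone_nat_of_le_succ (fun n => by rw [hus]; omega)
  have hσ : ∀ n v, (σ n v : ℤ) = σ 0 v + n * η v - G.degree v * (u n v : ℤ)
      + ∑ w ∈ G.neighborFinset v, (u n w : ℤ) := by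
    intro n v
    induction n with
    | zero => simp [hu0]
    | succ n ih =>
      rw [topples_eq G (hl n) v]
      simp only [hus, Pi.add_apply]
      push_cast
      rw [ih, Finset.sum_add_distrib]
      ring
  have hinv : ∀ n, Inv G {v | 0 < u n v} (σ n) := by
    intro n
    induction n with
    | zero =>
      intro A hA hAT
      obtain ⟨v, hv⟩ := hA
      have := hAT v hv
      simp [hu0] at this
    | succ n ih =>
      have h1 := inv_topples G (hl n) _ (inv_mono G ih (fun v => by simp))
      have h2 : {v | 0 < u (n + 1) v} = {v | 0 < u n v} ∪ {v | v ∈ l n} := by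
        ext v
        simp only [hus, Set.mem_setOf_eq, Set.mem_union, ← List.count_pos_iff]
        omega
      rw [h2]; exact h1
  let Unb : V → Prop := fun v => ∀ K, ∃ n, K < u n v
  have hadj : ∀ v w, G.Adj w v → Unb w → Unb v := by
    intro v w hvw hw
    by_contra hcon
    simp only [Unb, not_forall, not_exists, not_lt] at hcon
    obtain ⟨K, hK⟩ := hcon
    obtain ⟨n, hn⟩ := hw (σ 0 v + G.degree v + G.degree v * K)
    have h1 := hσ n v
    have h2 : (u n w : ℤ) ≤ ∑ w ∈ G.neighborFinset v, (u n w : ℤ) :=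
      Finset.single_le_sum (f := fun w => (u n w : ℤ)) (fun i _ => by positivity)
        (by simpa using hvw.symm)
    have h3 : (G.degree v : ℤ) * u n v ≤ G.degree v * K := by
      have := hK n
      gcongr
    have h4 : σ n v ≤ σ 0 v + G.degree v := by
      rcases Nat.eq_zero_or_pos n with rfl | h
      · omega
      · have := hst' n h v; omega
    have h5 : (0 : ℤ) ≤ n * η v := by positivity
    have hnb2 : n = 0 ∨ σ n v < G.degree v := by
      rcases Nat.eq_zero_or_pos n with rfl | h
      · left; rfl
      · right; exact hst' n h v
    zify at hn h4
    rcases hnb2 with rfl | h6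
    · simp only [hu0] at hn
      push_cast at hn
      have : (0 : ℤ) ≤ G.degree v * K := by positivity
      omega
    · zify at h6
      linarith
  by_cases hU : ∃ w, Unb w
  · have hall : ∀ v, Unb v := by
      obtain ⟨w, hw⟩ := hU
      intro v
      obtain ⟨p⟩ := hG.preconnected w v
      induction p with
      | nil => exact hw
      | cons h _ ih => exact ih (hadj _ _ h hw)
    have hN : ∀ᶠ n in Filter.atTop, ∀ v ∈ F, 0 < u n v := by
      rw [Filter.eventually_all_finite hFfin]
      intro v _
      obtain ⟨n, hn⟩ := hall v 0
      exact Filter.eventually_atTop.2 ⟨n, fun m hm => hn.trans_le (humono v hm)⟩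
    obtain ⟨N, hN⟩ := Filter.eventually_atTop.1 hN
    haveI : Fintype F := hFfin.fintype
    -- pigeonhole
    let f : ℕ → ((v : F) → Fin (G.degree v)) := fun n v => ⟨σ (n + 1) v, hst' _ (by omega) v⟩
    obtain ⟨i, j, hij, hfij⟩ : ∃ i j, i < j ∧ f i = f j := by
      obtain ⟨i, j, hne, h⟩ := Finite.exists_ne_map_eq_of_infinite f
      rcases lt_or_gt_of_ne hne with h' | h'
      · exact ⟨i, j, h', h⟩
      · exact ⟨j, i, h', h.symm⟩
    have hσij : ∀ v ∈ F, σ (i + 1) v = σ (j + 1) v := by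
      intro v hv
      have := congrFun hfij ⟨v, hv⟩
      simpa [f] using this
    let C : ℕ → ℕ := fun n => ∑ i ∈ Finset.range n, c i
    have hC : ∀ n, ∀ b ∈ B, u n b = C n := fun n b hb =>
      Finset.sum_congr rfl (fun i _ => hc i b hb)
    refine ⟨N + 1, j - i, by omega, ?_⟩
    intro n hn
    let q : ℕ → V → ℤ := fun n v => (u n v : ℤ) - C n
    have hq : ∀ n v, (σ n v : ℤ) = σ 0 v + n * η v - G.degree v * q n v
      + ∑ w ∈ G.neighborFinset v, q n w := by
      intro n v
      rw [hσ n v]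
      simp only [q, Finset.sum_sub_distrib, Finset.sum_const,
        SimpleGraph.card_neighborFinset_eq_degree, nsmul_eq_mul]
      ring
    let z : V → ℤ := fun v => q (n + (j - i)) v - q n v - (q (j + 1) v - q (i + 1) v)
    have hzB : ∀ b ∈ B, z b = 0 := by
      intro b hb
      simp [z, q, hC _ b hb]
    have hze : ∀ v ∈ F, (σ (n + (j - i)) v : ℤ) = σ n v - G.degree v * z v
        + ∑ w ∈ G.neighborFinset v, z w := by
      intro v hv
      have e1 := hq (n + (j - i)) v
      have e2 := hq n v
      have e3 := hq (j + 1) v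
      have e4 := hq (i + 1) v
      rw [← hσij v hv] at e3
      simp only [z, Finset.sum_sub_distrib]
      push_cast [hij.le] at e1 e3 e4
      linear_combination e1 - e2 - e3 + e4
    have hI : ∀ m, N ≤ m → Inv G F (σ m) := fun m hm A hA hAF =>
      hinv m A hA (fun v hv => hN m hm v (hAF v hv))
    have hz1 := nonpos_aux G hFfin hnb (fun v _ => hst' n (by omega) v)
      (hI (n + (j - i)) (by omega)) z hzB hze
    have hz2 := nonpos_aux G hFfin hnb (fun v _ => hst' (n + (j - i)) (by omega) v)
      (hI n (by omega)) (fun v => - z v) (fun b hb => by simp [hzB b hb]) (by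
        intro v hv
        have := hze v hv
        rw [Finset.sum_neg_distrib]
        linarith)
    have hz0 : ∀ v ∈ F, z v = 0 := fun v hv => by
      have h1 := hz1 v hv
      have h2 := hz2 v hv
      omega
    intro v hv
    have e := hze v hv
    rw [hz0 v hv, Finset.sum_eq_zero (fun w hw => by
      rcases hnb v hv w (by simpa using hw) with h | h
      · exact hz0 w h
      · exact hzB w h)] at e
    simpa using e
  · have hB : ∀ v, ∃ N, ∀ n, u n v ≤ u N v := by
      intro v
      have hv : ¬ Unb v := fun h => hU ⟨v, h⟩
      simp only [Unb, not_forall, not_exists, not_lt] at hv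
      obtain ⟨K, hK⟩ := hv
      have hbdd : BddAbove (Set.range (fun n => u n v)) := ⟨K, by rintro _ ⟨n, rfl⟩; exact hK n⟩
      obtain ⟨N, hN⟩ := Nat.sSup_mem (Set.range_nonempty (fun n => u n v)) hbdd
      refine ⟨N, fun n => ?_⟩
      have h1 : u n v ≤ sSup (Set.range (fun n => u n v)) := le_csSup hbdd ⟨n, rfl⟩
      rw [← hN] at h1
      exact h1
    have hev : ∀ᶠ n in Filter.atTop, ∀ v ∈ F ∪ B, u (n + 1) v = u n v := by
      rw [Filter.eventually_all_finite (hFfin.union hBfin)]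
      intro v _
      obtain ⟨N, hN⟩ := hB v
      refine Filter.eventually_atTop.2 ⟨N, fun n hn => ?_⟩
      have h1 := hN (n + 1)
      have h2 : u N v ≤ u n v := humono v hn
      have h3 : u n v ≤ u (n + 1) v := humono v (Nat.le_succ n)
      omega
    obtain ⟨N, hN⟩ := Filter.eventually_atTop.1 hev
    have hstep1 : ∀ n, N ≤ n → ∀ v ∈ F, σ (n + 1) v = σ n v + η v := by
      intro n hn v hv
      have e1 := hσ (n + 1) v
      have e2 := hσ n v
      rw [hN n hn v (Or.inl hv), Finset.sum_congr rfl (fun w hw => by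
        rw [hN n hn w (hnb v hv w (by simpa using hw))])] at e1
      zify
      push_cast at e1
      linarith
    refine ⟨N, 1, one_pos, fun n hn v hv => ?_⟩
    have hk : ∀ k, σ (N + k) v = σ N v + k * η v := by
      intro k
      induction k with
      | zero => simp
      | succ k ih =>
        rw [← add_assoc, hstep1 (N + k) (by omega) v hv, ih]; ring
    have h0 : η v = 0 := by
      by_contra hne
      have h1 := hk (G.degree v + 1)
      have h2 := hst' (N + (G.degree v + 1)) (by omega) v
      have h3 : (G.degree v + 1) * 1 ≤ (G.degree v + 1) * η v :=
        Nat.mul_le_mul_left _ (by omega)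
      omega
    rw [hstep1 n hn v hv, h0, add_zero]
end

section
/- For all levels n > 0, the identity element of the sandpile group of the level-n Sierpinski gasket cell graph SGC_n (in which each of the three boundary cell vertices has a single additional edge to the sink) is the configuration with exactly 2 chips on every vertex. Equivalently, the configuration with 4 chips on every vertex stabilizes to the configuration with 2 chips on every vertex, and in this stabilization the odometer of each boundary vertex is 2·3^{n−1}. -/
open Classical

open ASM

/-! ### The Sierpinski gasket cell graphs

Cells (upward triangles) of the level-`n` Sierpinski gasket are realized in triangular
coordinates: the cell with top corner `(r, c)` (rows `r = 0, …, 2^n - 1` from the top,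
`0 ≤ c ≤ r`) belongs to the gasket exactly when the binomial coefficient `r.choose c` is
odd; its three corners are `(r, c)`, `(r+1, c)` and `(r+1, c+1)`.  The level-`n` cell
graph `SGC_n` has one vertex for each cell, two distinct cells being adjacent exactly
when they share a corner.  Its three boundary (corner) cells are the cells at the three
corners of the gasket. -/

/-- `(r, c)` indexes an (upward) cell of the level-`n` Sierpinski gasket. -/
def IsCell (n r c : ℕ) : Prop := r < 2 ^ n ∧ c ≤ r ∧ ¬ (2 ∣ Nat.choose r c)

/-- `(x, y)` is one of the three corners of the cell with top corner `(r, c)`. -/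
def InCorners (r c x y : ℕ) : Prop :=
  (x = r ∧ y = c) ∨ (x = r + 1 ∧ y = c) ∨ (x = r + 1 ∧ y = c + 1)

/-- The type of cells of the level-`n` Sierpinski gasket. -/
def CellT (n : ℕ) : Type := {p : ℕ × ℕ // IsCell n p.1 p.2}

/-- Two distinct cells are adjacent in the cell graph when they share a corner. -/
def cellAdj (n : ℕ) (a b : CellT n) : Prop :=
  a ≠ b ∧ ∃ x y : ℕ, InCorners a.val.1 a.val.2 x y ∧ InCorners b.val.1 b.val.2 x y

/-- The three boundary (corner) cells of the level-`n` cell graph. -/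
def IsCornerCell (n : ℕ) (a : CellT n) : Prop :=
  a.val = (0, 0) ∨ a.val = (2 ^ n - 1, 0) ∨ a.val = (2 ^ n - 1, 2 ^ n - 1)

/-- The level-`n` Sierpinski gasket cell graph with a sink: one vertex per cell, two
distinct cells adjacent exactly when they share a corner, plus a single extra sink vertex
joined by one edge to each of the three boundary cells (so that every cell has degree
three). -/
def SGCgraph (n : ℕ) : SimpleGraph (CellT n ⊕ Unit) where
  Adj x y := x ≠ y ∧
    ((∃ a b : CellT n, x = Sum.inl a ∧ y = Sum.inl b ∧ cellAdj n a b) ∨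
      (∃ a : CellT n, IsCornerCell n a ∧
        ((x = Sum.inl a ∧ y = Sum.inr ()) ∨ (y = Sum.inl a ∧ x = Sum.inr ()))))
  symm := by
    constructor
    rintro x y ⟨hne, (⟨a, b, hx, hy, hab, hsh⟩ | ⟨a, hc, h⟩)⟩
    · exact ⟨hne.symm, Or.inl ⟨b, a, hy, hx, hab.symm, by tauto⟩⟩
    · exact ⟨hne.symm, Or.inr ⟨a, hc, h.symm⟩⟩
  loopless := by constructor; rintro x ⟨hne, -⟩; exact hne rfl

/-- The sink of the cell graph. -/
def sinkSet (n : ℕ) : Set (CellT n ⊕ Unit) := {Sum.inr ()}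

/-- The configuration with `m` chips on every cell (and none on the sink). -/
def constConf (n m : ℕ) : CellT n ⊕ Unit → ℕ := Sum.elim (fun _ => m) (fun _ => 0)

namespace ASM

variable {V : Type*} [Fintype V]

/-- Sum over neighbours. -/
noncomputable def nsum (G : SimpleGraph V) (u : V → ℤ) (v : V) : ℤ :=
  ∑ x, if G.Adj v x then u x else 0

/-- The graph Laplacian. -/
noncomputable def lap (G : SimpleGraph V) (u : V → ℤ) (v : V) : ℤ :=
  deg G v * u v - nsum G u v

lemma lap_sub (G : SimpleGraph V) (a b : V → ℤ) (v : V) :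
    lap G (fun x => a x - b x) v = lap G a v - lap G b v := by
  have : nsum G (fun x => a x - b x) v = nsum G a v - nsum G b v := by
    unfold nsum
    rw [← Finset.sum_sub_distrib]
    apply Finset.sum_congr rfl
    intro x _
    split_ifs <;> simp
  unfold lap
  rw [this]; ring

lemma lap_smul (G : SimpleGraph V) (k : ℤ) (a : V → ℤ) (v : V) :
    lap G (fun x => k * a x) v = k * lap G a v := by
  have : nsum G (fun x => k * a x) v = k * nsum G a v := by
    unfold nsum
    rw [Finset.mul_sum]
    apply Finset.sum_congr rfl
    intro x _
    split_ifs <;> simp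
  unfold lap
  rw [this]; ring

/-- Indicator of a vertex. -/
noncomputable def ind (v : V) : V → ℤ := fun x => if x = v then 1 else 0

lemma nsum_ind (G : SimpleGraph V) (v u : V) :
    nsum G (ind v) u = if G.Adj u v then 1 else 0 := by
  unfold nsum ind
  rw [Finset.sum_eq_single v]
  · simp
  · intro b _ hb; simp [hb]
  · simp

lemma toppleAt_eq (G : SimpleGraph V) (η : V → ℕ) (v : V) (h : deg G v ≤ η v) (u : V) :
    (toppleAt G η v u : ℤ) = η u - lap G (ind v) u := by
  unfold lap toppleAt
  rw [nsum_ind]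
  by_cases huv : u = v
  · subst huv
    simp [ind, h]
  · simp [ind, huv, G.adj_comm u v]

lemma nsum_symm (G : SimpleGraph V) (a b : V → ℤ) :
    ∑ v, a v * nsum G b v = ∑ v, b v * nsum G a v := by
  unfold nsum
  simp_rw [Finset.mul_sum]
  rw [Finset.sum_comm]
  apply Finset.sum_congr rfl; intro x _
  apply Finset.sum_congr rfl; intro y _
  simp only [G.adj_comm x y]
  split_ifs <;> ring

lemma lap_symm (G : SimpleGraph V) (a b : V → ℤ) :
    ∑ v, a v * lap G b v = ∑ v, b v * lap G a v := by
  unfold lap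
  simp_rw [mul_sub]
  rw [Finset.sum_sub_distrib, Finset.sum_sub_distrib, nsum_symm]
  congr 1
  apply Finset.sum_congr rfl; intro x _
  ring

/-- count as an integer function -/
noncomputable def cnt (l : List V) : V → ℤ := fun v => (l.count v : ℤ)

lemma cnt_cons (v : V) (l : List V) : cnt (v :: l) = fun x => cnt l x - (-1) * ind v x := by
  funext x
  unfold cnt ind
  rw [List.count_cons]
  by_cases h : x = v
  · simp [h]
  · simp [h, Ne.symm h]

lemma topples_eq_s17 (G : SimpleGraph V) (S : Set V) {η η' : V → ℕ} {l : List V}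
    (h : Topples G S η l η') : ∀ v, (η' v : ℤ) = η v - lap G (cnt l) v := by
  induction h with
  | nil η => intro v; simp [cnt, lap, nsum]
  | cons v hv hge ht ih =>
    intro x
    rw [ih x, toppleAt_eq G _ v hge, cnt_cons, lap_sub, lap_smul]
    ring

lemma cnt_sink (G : SimpleGraph V) (S : Set V) {η η' : V → ℕ} {l : List V}
    (h : Topples G S η l η') : ∀ v ∈ S, cnt l v = 0 := by
  induction h with
  | nil η => intro v _; simp [cnt]
  | cons v hv hge ht ih =>
    intro x hx
    rw [cnt_cons]
    have : x ≠ v := by rintro rfl; exact hv hx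
    simp [ih x hx, ind, this]

/-- `u` bounds the odometer of `η`. -/
def Bd (G : SimpleGraph V) (S : Set V) (η : V → ℕ) (u : V → ℤ) : Prop :=
  (∀ v, 0 ≤ u v) ∧ ∀ v, v ∉ S → (η v : ℤ) - lap G u v < deg G v

lemma Bd.step {G : SimpleGraph V} {S : Set V} {η : V → ℕ} {u : V → ℤ} (h : Bd G S η u)
    {v : V} (hv : v ∉ S) (hge : deg G v ≤ η v) :
    Bd G S (toppleAt G η v) (fun x => u x - ind v x) := by
  have h1 : 1 ≤ u v := by
    by_contra hc
    have h0 : u v = 0 := by have := h.1 v; omega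
    have h2 := h.2 v hv
    have h3 : 0 ≤ nsum G u v := by
      apply Finset.sum_nonneg
      intro x _
      split_ifs
      · exact h.1 x
      · rfl
    unfold lap at h2
    rw [h0] at h2
    have : (deg G v : ℤ) ≤ η v := by exact_mod_cast hge
    linarith
  refine ⟨fun x => ?_, fun x hx => ?_⟩
  · simp only [ind]
    split_ifs with hxv
    · subst hxv; omega
    · simpa using h.1 x
  · rw [toppleAt_eq G _ v hge, lap_sub]
    have := h.2 x hx
    linarith

lemma least_action {G : SimpleGraph V} {S : Set V} {η η' : V → ℕ} {l : List V}
    (ht : Topples G S η l η') : ∀ u : V → ℤ, Bd G S η u → ∀ v, cnt l v ≤ u v := by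
  induction ht with
  | nil η => intro u hu v; simpa [cnt] using hu.1 v
  | cons v hv hge ht ih =>
    intro u hu x
    have := ih _ (hu.step hv hge) x
    rw [cnt_cons]
    simp only at this ⊢
    linarith

lemma exists_stab (G : SimpleGraph V) (S : Set V) : ∀ (k : ℕ) (η : V → ℕ) (u : V → ℤ),
    Bd G S η u → ∑ v, u v ≤ k → ∃ l η', Topples G S η l η' ∧ Stable G S η' := by
  intro k
  induction k with
  | zero =>
    intro η u hu hs
    by_cases hst : Stable G S η
    · exact ⟨[], η, Topples.nil η, hst⟩
    · unfold Stable at hst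
      push Not at hst
      obtain ⟨v, hv, hge⟩ := hst
      have h1 := hu.step hv hge
      have h2 : 0 ≤ ∑ x, (u x - ind v x) := Finset.sum_nonneg (fun x _ => h1.1 x)
      rw [Finset.sum_sub_distrib] at h2
      have h3 : ∑ x, ind v x = 1 := by simp [ind]
      rw [h3] at h2
      push_cast at hs
      omega
  | succ k ih =>
    intro η u hu hs
    by_cases hst : Stable G S η
    · exact ⟨[], η, Topples.nil η, hst⟩
    · unfold Stable at hst
      push Not at hst
      obtain ⟨v, hv, hge⟩ := hst
      have h1 := hu.step hv hge
      have h3 : ∑ x, ind v x = 1 := by simp [ind]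
      obtain ⟨l, η', hl, hs'⟩ := ih _ _ h1 (by
        rw [Finset.sum_sub_distrib, h3]; push_cast at hs; omega)
      exact ⟨v :: l, η', Topples.cons v hv hge hl, hs'⟩

lemma Bd.exists_stab {G : SimpleGraph V} {S : Set V} {η : V → ℕ} {u : V → ℤ}
    (h : Bd G S η u) : ∃ l η', Topples G S η l η' ∧ Stable G S η' :=
  ASM.exists_stab G S (∑ v, u v).toNat η u h (Int.self_le_toNat _)

lemma Topples.bd {G : SimpleGraph V} {S : Set V} {η η' : V → ℕ} {l : List V}
    (h : Topples G S η l η') (hs : Stable G S η') : Bd G S η (cnt l) := by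
  refine ⟨fun v => by unfold cnt; positivity, fun v hv => ?_⟩
  rw [← topples_eq_s17 G S h v]
  exact_mod_cast hs v hv

lemma stab_unique {G : SimpleGraph V} {S : Set V} {η η₁ η₂ : V → ℕ} {l₁ l₂ : List V}
    (h₁ : Topples G S η l₁ η₁) (s₁ : Stable G S η₁)
    (h₂ : Topples G S η l₂ η₂) (s₂ : Stable G S η₂) : η₁ = η₂ := by
  have : cnt l₁ = cnt l₂ := by
    funext v
    exact le_antisymm (least_action h₁ _ (h₂.bd s₂) v) (least_action h₂ _ (h₁.bd s₁) v)
  funext v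
  have e1 := topples_eq_s17 G S h₁ v
  have e2 := topples_eq_s17 G S h₂ v
  rw [this, ← e2] at e1
  exact_mod_cast e1

lemma Topples.append {G : SimpleGraph V} {S : Set V} {η η₁ η₂ : V → ℕ} {l₁ l₂ : List V}
    (h₁ : Topples G S η l₁ η₁) (h₂ : Topples G S η₁ l₂ η₂) : Topples G S η (l₁ ++ l₂) η₂ := by
  induction h₁ with
  | nil η => exact h₂
  | cons v hv hge ht ih => exact Topples.cons v hv hge (ih h₂)

lemma Topples.add {G : SimpleGraph V} {S : Set V} {η η' : V → ℕ} {l : List V}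
    (h : Topples G S η l η') (τ : V → ℕ) : Topples G S (η + τ) l (η' + τ) := by
  induction h with
  | nil η => exact Topples.nil _
  | @cons η η' l v hv hge ht ih =>
    refine Topples.cons v hv (le_trans hge (by simp)) ?_
    have : toppleAt G (η + τ) v = toppleAt G η v + τ := by
      funext x
      simp only [toppleAt, Pi.add_apply]
      by_cases hx : x = v
      · subst hx; simp; omega
      · simp [hx]; omega
    rw [this]; exact ih

lemma Topples.congr {G : SimpleGraph V} {S : Set V} {η η' : V → ℕ} {l : List V}
    (h : Topples G S η l η') : ∀ ζ : V → ℕ, (∀ v, v ∉ S → ζ v = η v) →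
      ∃ ζ', Topples G S ζ l ζ' ∧ ∀ v, v ∉ S → ζ' v = η' v := by
  induction h with
  | nil η => intro ζ hζ; exact ⟨ζ, Topples.nil ζ, hζ⟩
  | @cons η η' l v hv hge ht ih =>
    intro ζ hζ
    obtain ⟨ζ', h1, h2⟩ := ih (toppleAt G ζ v) (by
      intro x hx
      unfold toppleAt
      rw [hζ v hv, hζ x hx])
    exact ⟨ζ', Topples.cons v hv (by rw [hζ v hv]; exact hge) h1, h2⟩

/-- abstract core -/
theorem core (G : SimpleGraph V) (S : Set V) (hdeg : ∀ v, v ∉ S → deg G v = 3)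
    (u : V → ℤ) (hu0 : ∀ v, 0 ≤ u v) (huS : ∀ v ∈ S, u v = 0)
    (hlap : ∀ v, v ∉ S → lap G u v = 2) (k : ℕ) (η : V → ℕ)
    (hη : ∀ v, v ∉ S → η v = 2 + 2 * k) :
    ∃ l η', Topples G S η l η' ∧ Stable G S η' ∧ (∀ v, v ∉ S → η' v = 2) ∧
      ∀ v, (cnt l v : ℤ) = k * u v := by
  have hB : Bd G S η (fun x => k * u x) := by
    refine ⟨fun v => mul_nonneg (by positivity) (hu0 v), fun v hv => ?_⟩
    rw [lap_smul, hlap v hv, hη v hv, hdeg v hv]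
    push_cast; linarith
  obtain ⟨l, η', hl, hs⟩ := hB.exists_stab
  have hle := least_action hl _ hB
  have hd : ∀ v, v ∉ S → lap G (fun x => k * u x - cnt l x) v = η' v - 2 := by
    intro v hv
    rw [lap_sub, lap_smul, hlap v hv, topples_eq_s17 G S hl v, hη v hv]
    push_cast; ring
  have hsum := lap_symm G u (fun x => k * u x - cnt l x)
  have h1 : ∑ v, u v * lap G (fun x => k * u x - cnt l x) v ≤ 0 := by
    apply Finset.sum_nonpos
    intro v _
    by_cases hv : v ∈ S
    · simp [huS v hv]
    · rw [hd v hv]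
      have := hs v hv
      rw [hdeg v hv] at this
      apply mul_nonpos_of_nonneg_of_nonpos (hu0 v)
      omega
  have hnn : ∀ v ∈ Finset.univ, 0 ≤ (fun x => k * u x - cnt l x) v * lap G u v := by
    intro v _
    by_cases hv : v ∈ S
    · simp [huS v hv, cnt_sink G S hl v hv]
    · rw [hlap v hv]
      have := hle v
      simp only at this ⊢
      linarith
  have h0 := (Finset.sum_eq_zero_iff_of_nonneg hnn).1
    (le_antisymm (hsum ▸ h1) (Finset.sum_nonneg hnn))
  have hc : ∀ v, cnt l v = k * u v := by
    intro v
    by_cases hv : v ∈ S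
    · simp [huS v hv, cnt_sink G S hl v hv]
    · have := h0 v (Finset.mem_univ v)
      rw [hlap v hv] at this
      simp only at this
      linarith
  refine ⟨l, η', hl, hs, fun v hv => ?_, hc⟩
  have := hd v hv
  have he : (fun x => k * u x - cnt l x) = fun x => (0:ℤ) * u x := by
    funext x; rw [hc x]; ring
  rw [he, lap_smul] at this
  omega

theorem core2 (G : SimpleGraph V) (S : Set V) (hdeg : ∀ v, v ∉ S → deg G v = 3)
    (u : V → ℤ) (hu0 : ∀ v, 0 ≤ u v) (huS : ∀ v ∈ S, u v = 0)
    (hlap : ∀ v, v ∉ S → lap G u v = 2) (two : V → ℕ) (h2 : ∀ v, v ∉ S → two v = 2) :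
    Recurrent G S two ∧ ∀ c, Recurrent G S c → ∃ c', StabilizesTo G S (c + two) c' ∧
      ∀ v, v ∉ S → c' v = c v := by
  refine ⟨⟨fun v hv => by rw [h2 v hv, hdeg v hv]; norm_num, fun σ => ?_⟩, fun c hc => ?_⟩
  · obtain ⟨l, η', hl, hs, he, -⟩ := core G S hdeg u hu0 huS hlap (∑ v, σ v)
      (σ + fun v => 2 + 2 * (∑ v, σ v) - σ v) (by
        intro v _
        have : σ v ≤ ∑ v, σ v := Finset.single_le_sum (fun _ _ => Nat.zero_le _) (Finset.mem_univ v)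
        simp only [Pi.add_apply]
        omega)
    exact ⟨_, η', ⟨l, hl, hs⟩, fun v hv => by rw [he v hv, h2 v hv]⟩
  · obtain ⟨τ, c₁, ⟨l₂, hl₂, hs₂⟩, hc₁⟩ := hc.2 two
    obtain ⟨l₁, η₁, hl₁, -, he₁, -⟩ := core G S hdeg u hu0 huS hlap 1 (two + two) (by
      intro v hv; simp [h2 v hv])
    -- route 1
    have r1 := hl₁.add τ
    obtain ⟨c₂, r2, hc₂⟩ := hl₂.congr (η₁ + τ) (by
      intro v hv; simp [he₁ v hv, h2 v hv])
    have R1 := r1.append r2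
    have hsc₂ : Stable G S c₂ := fun v hv => by rw [hc₂ v hv]; exact hs₂ v hv
    -- route 2
    have q1 := hl₂.add two
    have hB : Bd G S (c + two) u := by
      refine ⟨hu0, fun v hv => ?_⟩
      have := hc.1 v hv
      rw [hlap v hv]
      simp only [Pi.add_apply, h2 v hv]
      push_cast
      have h' : (c v : ℤ) < deg G v := by exact_mod_cast this
      linarith
    obtain ⟨l₃, c', hl₃, hs₃⟩ := hB.exists_stab
    obtain ⟨c₃, q2, hc₃⟩ := hl₃.congr (c₁ + two) (by
      intro v hv; simp [hc₁ v hv])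
    have R2 := q1.append q2
    have hsc₃ : Stable G S c₃ := fun v hv => by rw [hc₃ v hv]; exact hs₃ v hv
    have hX : two + τ + two = two + two + τ := by ring
    rw [hX] at R2
    have := stab_unique R1 hsc₂ R2 hsc₃
    refine ⟨c', ⟨l₃, hl₃, hs₃⟩, fun v hv => ?_⟩
    rw [← hc₃ v hv, ← this, hc₂ v hv, hc₁ v hv]

end ASM

/-- Recursive description of cells. -/
def Cel : ℕ → ℤ → ℤ → Prop
  | 0, x, y => x = 0 ∧ y = 0
  | m + 1, x, y => Cel m x y ∨ Cel m (x - 2 ^ m) y ∨ Cel m (x - 2 ^ m) (y - 2 ^ m)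

lemma Cel.tri : ∀ {m : ℕ} {x y : ℤ}, Cel m x y → 0 ≤ y ∧ y ≤ x ∧ x < 2 ^ m
  | 0, x, y, h => by obtain ⟨rfl, rfl⟩ := h; simp
  | m + 1, x, y, h => by
    have hp : (0:ℤ) < 2 ^ m := by positivity
    rw [pow_succ]
    rcases h with h | h | h
    all_goals
      have := h.tri
      omega

/-- sum over the six lattice neighbours -/
def six (f : ℤ → ℤ → ℤ) (x y : ℤ) : ℤ :=
  f (x - 1) y + f (x - 1) (y - 1) + f (x + 1) y + f (x + 1) (y + 1) + f x (y - 1) + f x (y + 1)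

/-- `f` solves Laplace equation with right side `κ`, corner values `a b c`, outside values
`a' b' c'`. -/
structure IsSol (κ : ℤ) (m : ℕ) (f : ℤ → ℤ → ℤ) (a b c a' b' c' : ℤ) : Prop where
  supp : ∀ x y, ¬ Cel m x y → f x y = 0
  top : f 0 0 = a
  bl : f (2 ^ m - 1) 0 = b
  br : f (2 ^ m - 1) (2 ^ m - 1) = c
  eq : ∀ x y, Cel m x y → 3 * f x y = κ + six f x y + (if x = 0 ∧ y = 0 then a' else 0)
    + (if x = 2 ^ m - 1 ∧ y = 0 then b' else 0)
    + (if x = 2 ^ m - 1 ∧ y = 2 ^ m - 1 then c' else 0)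

/-- Gluing. -/
def glue (m : ℕ) (f g h : ℤ → ℤ → ℤ) (x y : ℤ) : ℤ :=
  f x y + g (x - 2 ^ m) y + h (x - 2 ^ m) (y - 2 ^ m)

lemma six_glue (m : ℕ) (f g h : ℤ → ℤ → ℤ) (x y : ℤ) :
    six (glue m f g h) x y = six f x y + six g (x - 2 ^ m) y + six h (x - 2 ^ m) (y - 2 ^ m) := by
  unfold six glue
  have e1 : x - 1 - 2 ^ m = x - 2 ^ m - 1 := by ring
  have e2 : x + 1 - 2 ^ m = x - 2 ^ m + 1 := by ring
  have e3 : y - 1 - 2 ^ m = y - 2 ^ m - 1 := by ring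
  have e4 : y + 1 - 2 ^ m = y - 2 ^ m + 1 := by ring
  rw [e1, e2, e3, e4]
  ring

/-- zero outside triangle, with known corners -/
lemma IsSol.zero {κ : ℤ} {m : ℕ} {f : ℤ → ℤ → ℤ} {a b c a' b' c' : ℤ}
    (h : IsSol κ m f a b c a' b' c') {x y : ℤ} (hx : ¬ (0 ≤ y ∧ y ≤ x ∧ x < 2 ^ m)) :
    f x y = 0 := h.supp x y (fun hc => hx hc.tri)

section six_out
variable {κ : ℤ} {m : ℕ} {f : ℤ → ℤ → ℤ} {a b c a' b' c' : ℤ}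

lemma IsSol.six1 (h : IsSol κ m f a b c a' b' c') {x y : ℤ} (h1 : x < 0) (h2 : 0 ≤ y)
    (h3 : y ≤ x + 2 ^ m) : six f x y = if x = -1 ∧ y = 0 then a else 0 := by
  have hp : (0:ℤ) < 2 ^ m := by positivity
  unfold six
  rw [h.zero (x := x - 1) (y := y) (by omega),
    h.zero (x := x - 1) (y := y - 1) (by omega),
    h.zero (x := x + 1) (y := y + 1) (by omega),
    h.zero (x := x) (y := y - 1) (by omega),
    h.zero (x := x) (y := y + 1) (by omega)]
  split_ifs with hc
  · obtain ⟨rfl, rfl⟩ := hc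
    simpa using h.top
  · rw [h.zero (by omega)]; simp

lemma IsSol.six2 (h : IsSol κ m f a b c a' b' c') {x y : ℤ} (h1 : x < 0) (h2 : y ≤ x)
    (h3 : -2 ^ m ≤ y) : six f x y = if x = -1 ∧ y = -1 then a else 0 := by
  have hp : (0:ℤ) < 2 ^ m := by positivity
  unfold six
  rw [h.zero (x := x - 1) (y := y) (by omega),
    h.zero (x := x - 1) (y := y - 1) (by omega),
    h.zero (x := x + 1) (y := y) (by omega),
    h.zero (x := x) (y := y - 1) (by omega),
    h.zero (x := x) (y := y + 1) (by omega)]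
  split_ifs with hc
  · obtain ⟨rfl, rfl⟩ := hc
    simpa using h.top
  · rw [h.zero (by omega)]; simp

lemma IsSol.six3 (h : IsSol κ m f a b c a' b' c') {x y : ℤ} (h1 : 2 ^ m ≤ x) (h2 : 0 ≤ y)
    (h3 : y ≤ x - 2 ^ m) : six f x y = if x = 2 ^ m ∧ y = 0 then b else 0 := by
  have hp : (0:ℤ) < 2 ^ m := by positivity
  unfold six
  rw [h.zero (x := x - 1) (y := y - 1) (by omega),
    h.zero (x := x + 1) (y := y) (by omega),
    h.zero (x := x + 1) (y := y + 1) (by omega),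
    h.zero (x := x) (y := y - 1) (by omega),
    h.zero (x := x) (y := y + 1) (by omega)]
  split_ifs with hc
  · obtain ⟨rfl, rfl⟩ := hc
    simpa using h.bl
  · rw [h.zero (by omega)]; simp

lemma IsSol.six4 (h : IsSol κ m f a b c a' b' c') {x y : ℤ} (h1 : x < 2 ^ m) (h2 : y < 0)
    (h3 : y ≤ x - 2 ^ m) : six f x y = if x = 2 ^ m - 1 ∧ y = -1 then b else 0 := by
  have hp : (0:ℤ) < 2 ^ m := by positivity
  unfold six
  rw [h.zero (x := x - 1) (y := y) (by omega),
    h.zero (x := x - 1) (y := y - 1) (by omega),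
    h.zero (x := x + 1) (y := y) (by omega),
    h.zero (x := x + 1) (y := y + 1) (by omega),
    h.zero (x := x) (y := y - 1) (by omega)]
  split_ifs with hc
  · obtain ⟨rfl, rfl⟩ := hc
    simpa using h.bl
  · rw [h.zero (by omega)]; simp

lemma IsSol.six5 (h : IsSol κ m f a b c a' b' c') {x y : ℤ} (h1 : 2 ^ m ≤ x) (h2 : 2 ^ m ≤ y)
    (h3 : y ≤ x) : six f x y = if x = 2 ^ m ∧ y = 2 ^ m then c else 0 := by
  have hp : (0:ℤ) < 2 ^ m := by positivity
  unfold six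
  rw [h.zero (x := x - 1) (y := y) (by omega),
    h.zero (x := x + 1) (y := y) (by omega),
    h.zero (x := x + 1) (y := y + 1) (by omega),
    h.zero (x := x) (y := y - 1) (by omega),
    h.zero (x := x) (y := y + 1) (by omega)]
  split_ifs with hc
  · obtain ⟨rfl, rfl⟩ := hc
    simpa using h.br
  · rw [h.zero (by omega)]; simp

lemma IsSol.six6 (h : IsSol κ m f a b c a' b' c') {x y : ℤ} (h1 : x < 2 ^ m) (h2 : 0 ≤ x)
    (h3 : 2 ^ m ≤ y) : six f x y = if x = 2 ^ m - 1 ∧ y = 2 ^ m then c else 0 := by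
  have hp : (0:ℤ) < 2 ^ m := by positivity
  unfold six
  rw [h.zero (x := x - 1) (y := y) (by omega),
    h.zero (x := x - 1) (y := y - 1) (by omega),
    h.zero (x := x + 1) (y := y) (by omega),
    h.zero (x := x + 1) (y := y + 1) (by omega),
    h.zero (x := x) (y := y + 1) (by omega)]
  split_ifs with hc
  · obtain ⟨rfl, rfl⟩ := hc
    simpa using h.br
  · rw [h.zero (by omega)]; simp

end six_out

lemma IsSol.glue {κ : ℤ} {m : ℕ} {f g h : ℤ → ℤ → ℤ}
    {a b c a' b' c' a₁ b₁ c₁ a₁' b₁' c₁' a₂ b₂ c₂ a₂' b₂' c₂' : ℤ}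
    (hf : IsSol κ m f a b c a' b' c') (hg : IsSol κ m g a₁ b₁ c₁ a₁' b₁' c₁')
    (hh : IsSol κ m h a₂ b₂ c₂ a₂' b₂' c₂')
    (e1 : b' = a₁) (e2 : a₁' = b) (e3 : c' = a₂) (e4 : a₂' = c) (e5 : c₁' = b₂) (e6 : b₂' = c₁) :
    IsSol κ (m + 1) (_root_.glue m f g h) a b₁ c₂ a' b₁' c₂' := by
  have hp : (0:ℤ) < 2 ^ m := by positivity
  have hq : (2:ℤ) ^ (m + 1) = 2 * 2 ^ m := by ring
  subst e1 e2 e3 e4 e5 e6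
  refine ⟨?_, ?_, ?_, ?_, ?_⟩
  · intro x y hc
    simp only [Cel, not_or] at hc
    simp [_root_.glue, hf.supp _ _ hc.1, hg.supp _ _ hc.2.1, hh.supp _ _ hc.2.2]
  · unfold _root_.glue
    rw [hf.top, hg.zero (by omega), hh.zero (by omega)]; simp
  · unfold _root_.glue
    rw [hf.zero (by omega), hh.zero (by omega), ← hg.bl]
    rw [hq]; ring_nf
  · unfold _root_.glue
    rw [hf.zero (by omega), hg.zero (by omega), ← hh.br]
    rw [hq]; ring_nf
  · intro x y hc
    rw [six_glue, hq]
    unfold _root_.glue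
    rcases hc with hc | hc | hc
    · have ht := hc.tri
      have := hf.eq x y hc
      rw [hg.zero (by omega), hh.zero (by omega), hg.six1 (by omega) (by omega) (by omega),
        hh.six2 (by omega) (by omega) (by omega)]
      split_ifs at this ⊢ <;> omega
    · have ht := hc.tri
      have := hg.eq _ _ hc
      rw [hf.zero (by omega), hh.zero (by omega), hf.six3 (by omega) (by omega) (by omega),
        hh.six4 (by omega) (by omega) (by omega)]
      split_ifs at this ⊢ <;> omega
    · have ht := hc.tri
      have := hh.eq _ _ hc
      rw [hf.zero (by omega), hg.zero (by omega), hf.six5 (by omega) (by omega) (by omega),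
        hg.six6 (by omega) (by omega) (by omega)]
      split_ifs at this ⊢ <;> omega

/-- resistance numerators -/
def rr : ℕ → ℤ
  | 0 => 0
  | m + 1 => 5 * rr m + 3 ^ m

lemma rr_eq (m : ℕ) : 2 * rr m + 3 ^ m = 5 ^ m := by
  induction m with
  | zero => simp [rr]
  | succ m ih => simp only [rr, pow_succ]; linarith

lemma exists_sol (κ : ℤ) : ∀ (m : ℕ) (s A B C : ℤ), A + B + C = κ → ∃ f,
    IsSol κ m f (s - rr m * A) (s - rr m * B) (s - rr m * C)
      (s - (rr m + 3 ^ m) * A) (s - (rr m + 3 ^ m) * B) (s - (rr m + 3 ^ m) * C) := by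
  intro m
  induction m with
  | zero =>
    intro s A B C h
    refine ⟨fun x y => if x = 0 ∧ y = 0 then s else 0, ?_, ?_, ?_, ?_, ?_⟩
    · intro x y hc
      exact if_neg hc
    · simp [rr]
    · simp [rr]
    · simp [rr]
    · rintro x y ⟨rfl, rfl⟩
      simp [six, rr]
      linarith
  | succ m ih =>
    intro s A B C h
    have hr := rr_eq m
    obtain ⟨f, hf⟩ := ih (s - 5 ^ m * A) (3 * A) (B - A) (C - A) (by linarith)
    obtain ⟨g, hg⟩ := ih (s - 5 ^ m * B) (A - B) (3 * B) (C - B) (by linarith)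
    obtain ⟨k, hk⟩ := ih (s - 5 ^ m * C) (A - C) (B - C) (3 * C) (by linarith)
    rw [← hr] at hf hg hk
    refine ⟨_root_.glue m f g k, ?_⟩
    have := hf.glue hg hk (by ring) (by ring) (by ring) (by ring) (by ring) (by ring)
    simp only [rr, pow_succ]
    convert this using 1 <;> ring

lemma exists_one : ∀ m : ℕ, ∃ f, IsSol 0 m f 1 1 1 1 1 1 ∧ ∀ x y, Cel m x y → f x y = 1 := by
  intro m
  induction m with
  | zero =>
    refine ⟨fun x y => if x = 0 ∧ y = 0 then 1 else 0, ⟨?_, ?_, ?_, ?_, ?_⟩, ?_⟩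
    · intro x y hc
      exact if_neg hc
    · simp
    · simp
    · simp
    · rintro x y ⟨rfl, rfl⟩
      simp [six]
    · rintro x y ⟨rfl, rfl⟩
      simp
  | succ m ih =>
    obtain ⟨f, hf, h1⟩ := ih
    have hp : (0:ℤ) < 2 ^ m := by positivity
    refine ⟨_root_.glue m f f f, hf.glue hf hf rfl rfl rfl rfl rfl rfl, ?_⟩
    intro x y hc
    unfold _root_.glue
    rcases hc with hc | hc | hc
    · have ht := hc.tri
      rw [h1 _ _ hc, hf.zero (x := x - 2 ^ m) (y := y) (by omega),
        hf.zero (x := x - 2 ^ m) (y := y - 2 ^ m) (by omega)]; simp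
    · have ht := hc.tri
      rw [h1 _ _ hc, hf.zero (x := x) (y := y) (by omega),
        hf.zero (x := x - 2 ^ m) (y := y - 2 ^ m) (by omega)]; simp
    · have ht := hc.tri
      rw [h1 _ _ hc, hf.zero (x := x - 2 ^ m) (y := y) (by omega),
        hf.zero (x := x) (y := y) (by omega)]; simp

lemma exists_two (m : ℕ) : ∃ f, IsSol 2 (m + 1) f (2 * 3 ^ m) (2 * 3 ^ m) (2 * 3 ^ m) 0 0 0 := by
  have hr := rr_eq m
  obtain ⟨f, hf⟩ := exists_sol 2 m (5 ^ m + 3 ^ m) 2 0 0 (by simp)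
  obtain ⟨g, hg⟩ := exists_sol 2 m (5 ^ m + 3 ^ m) 0 2 0 (by simp)
  obtain ⟨k, hk⟩ := exists_sol 2 m (5 ^ m + 3 ^ m) 0 0 2 (by simp)
  rw [← hr] at hf hg hk
  refine ⟨_root_.glue m f g k, ?_⟩
  have := hf.glue hg hk (by ring) (by ring) (by ring) (by ring) (by ring) (by ring)
  convert this using 1 <;> ring

lemma choose_pow_add : ∀ (m r c : ℕ), r < 2 ^ m → c < 2 ^ m →
    (Nat.choose (2 ^ m + r) c ≡ Nat.choose r c [MOD 2]) ∧
    (Nat.choose (2 ^ m + r) (2 ^ m + c) ≡ Nat.choose r c [MOD 2]) := by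
  intro m
  have : Fact (Nat.Prime 2) := ⟨Nat.prime_two⟩
  induction m with
  | zero =>
    intro r c hr hc
    have hr : r = 0 := by simpa using hr
    have hc : c = 0 := by simpa using hc
    subst hr hc
    exact ⟨by decide, by decide⟩
  | succ m ih =>
    intro r c hr hc
    rw [pow_succ] at hr hc ⊢
    obtain ⟨i1, i2⟩ := ih (r / 2) (c / 2) (by omega) (by omega)
    have m1 : (2 ^ m * 2 + r) % 2 = r % 2 := by omega
    have m2 : (2 ^ m * 2 + c) % 2 = c % 2 := by omega
    have d1 : (2 ^ m * 2 + r) / 2 = 2 ^ m + r / 2 := by omega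
    have d2 : (2 ^ m * 2 + c) / 2 = 2 ^ m + c / 2 := by omega
    have L0 := Choose.choose_modEq_choose_mod_mul_choose_div_nat (p := 2) (n := r) (k := c)
    have L1 := Choose.choose_modEq_choose_mod_mul_choose_div_nat (p := 2) (n := 2 ^ m * 2 + r) (k := c)
    have L2 := Choose.choose_modEq_choose_mod_mul_choose_div_nat (p := 2) (n := 2 ^ m * 2 + r)
      (k := 2 ^ m * 2 + c)
    rw [m1, d1] at L1 L2
    rw [m2, d2] at L2
    exact ⟨L1.trans ((Nat.ModEq.mul_left _ i1).trans L0.symm),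
      L2.trans ((Nat.ModEq.mul_left _ i2).trans L0.symm)⟩

lemma odd_le {r c : ℕ} (h : ¬ 2 ∣ Nat.choose r c) : c ≤ r := by
  by_contra hc
  apply h
  rw [Nat.choose_eq_zero_of_lt (by omega)]
  exact dvd_zero 2

lemma isCell_iff (n : ℕ) : ∀ r c : ℕ, IsCell n r c ↔ Cel n (r : ℤ) (c : ℤ) := by
  induction n with
  | zero =>
    intro r c
    unfold IsCell Cel
    constructor
    · rintro ⟨h1, h2, -⟩
      simp at h1
      omega
    · rintro ⟨h1, h2⟩
      have h1 : r = 0 := by omega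
      have h2 : c = 0 := by omega
      subst h1 h2
      simp
  | succ m ih =>
    intro r c
    have hp : ((2 ^ m : ℕ) : ℤ) = (2:ℤ) ^ m := by push_cast; rfl
    have hpos : 0 < 2 ^ m := by positivity
    constructor
    · rintro ⟨h1, h2, h3⟩
      rw [pow_succ] at h1
      unfold Cel
      by_cases hr : r < 2 ^ m
      · left; exact (ih r c).1 ⟨hr, h2, h3⟩
      · right
        obtain ⟨r', rfl⟩ := Nat.exists_eq_add_of_le (not_lt.1 hr)
        have er : (((2 ^ m + r' : ℕ) : ℤ) - 2 ^ m) = (r' : ℤ) := by push_cast; ring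
        by_cases hc : c < 2 ^ m
        · left
          have := (choose_pow_add m r' c (by omega) hc).1
          have h4 : ¬ 2 ∣ Nat.choose r' c := by
            rwa [← (this.dvd_iff (dvd_refl 2))]
          rw [er]
          exact (ih r' c).1 ⟨by omega, odd_le h4, h4⟩
        · right
          obtain ⟨c', rfl⟩ := Nat.exists_eq_add_of_le (not_lt.1 hc)
          have ec : (((2 ^ m + c' : ℕ) : ℤ) - 2 ^ m) = (c' : ℤ) := by push_cast; ring
          have := (choose_pow_add m r' c' (by omega) (by omega)).2
          have h4 : ¬ 2 ∣ Nat.choose r' c' := by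
            rwa [← (this.dvd_iff (dvd_refl 2))]
          rw [er, ec]
          exact (ih r' c').1 ⟨by omega, odd_le h4, h4⟩
    · rintro (h | h | h)
      · obtain ⟨h1, h2, h3⟩ := (ih r c).2 h
        exact ⟨by rw [pow_succ]; omega, h2, h3⟩
      · have ht := h.tri
        obtain ⟨r', rfl⟩ := Nat.exists_eq_add_of_le (show 2 ^ m ≤ r by zify; omega)
        have er : (((2 ^ m + r' : ℕ) : ℤ) - 2 ^ m) = (r' : ℤ) := by push_cast; ring
        rw [er] at h
        obtain ⟨h1, h2, h3⟩ := (ih r' c).2 h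
        have := (choose_pow_add m r' c (by omega) (by omega)).1
        exact ⟨by rw [pow_succ]; omega, by omega, by rwa [this.dvd_iff (dvd_refl 2)]⟩
      · have ht := h.tri
        obtain ⟨r', rfl⟩ := Nat.exists_eq_add_of_le (show 2 ^ m ≤ r by zify; omega)
        obtain ⟨c', rfl⟩ := Nat.exists_eq_add_of_le (show 2 ^ m ≤ c by zify; omega)
        have er : (((2 ^ m + r' : ℕ) : ℤ) - 2 ^ m) = (r' : ℤ) := by push_cast; ring
        have ec : (((2 ^ m + c' : ℕ) : ℤ) - 2 ^ m) = (c' : ℤ) := by push_cast; ring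
        rw [er, ec] at h
        obtain ⟨h1, h2, h3⟩ := (ih r' c').2 h
        have := (choose_pow_add m r' c' (by omega) (by omega)).2
        exact ⟨by rw [pow_succ]; omega, by omega, by rwa [this.dvd_iff (dvd_refl 2)]⟩

noncomputable instance cellFintype (n : ℕ) : Fintype (CellT n) := by
  have : Set.Finite {p : ℕ × ℕ | IsCell n p.1 p.2} := by
    apply Set.Finite.subset ((Set.finite_Iio (2 ^ n)).prod (Set.finite_Iio (2 ^ n)))
    rintro ⟨r, c⟩ ⟨h1, h2, -⟩
    exact ⟨h1, lt_of_le_of_lt h2 h1⟩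
  exact this.fintype

/-- coordinates -/
def cx {n : ℕ} (a : CellT n) : ℤ := (a.val.1 : ℤ)
/-- coordinates -/
def cy {n : ℕ} (a : CellT n) : ℤ := (a.val.2 : ℤ)

lemma cel_c {n : ℕ} (a : CellT n) : Cel n (cx a) (cy a) := (isCell_iff n _ _).1 a.2

lemma c_ext {n : ℕ} {a b : CellT n} (h1 : cx a = cx b) (h2 : cy a = cy b) : a = b := by
  apply Subtype.ext
  apply Prod.ext
  · exact Int.ofNat_inj.1 h1
  · exact Int.ofNat_inj.1 h2

lemma c_surj {n : ℕ} {x y : ℤ} (h : Cel n x y) : ∃ a : CellT n, cx a = x ∧ cy a = y := by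
  have ht := h.tri
  obtain ⟨r, rfl⟩ := Int.eq_ofNat_of_zero_le (show 0 ≤ x by omega)
  obtain ⟨c, rfl⟩ := Int.eq_ofNat_of_zero_le (show 0 ≤ y by omega)
  exact ⟨⟨(r, c), (isCell_iff n r c).2 h⟩, rfl, rfl⟩

lemma sum_cell {n : ℕ} (f : ℤ → ℤ → ℤ) (hf : ∀ x y, ¬ Cel n x y → f x y = 0) (x y : ℤ) :
    (∑ b : CellT n, if cx b = x ∧ cy b = y then f (cx b) (cy b) else 0) = f x y := by
  by_cases h : Cel n x y
  · obtain ⟨a, rfl, rfl⟩ := c_surj h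
    rw [Finset.sum_eq_single a]
    · simp
    · intro b _ hb
      apply if_neg
      rintro ⟨h1, h2⟩
      exact hb (c_ext h1 h2)
    · simp
  · rw [hf x y h]
    apply Finset.sum_eq_zero
    intro b _
    apply if_neg
    rintro ⟨rfl, rfl⟩
    exact h (cel_c b)

lemma cellAdj_iff {n : ℕ} (a b : CellT n) : cellAdj n a b ↔
    (cx b = cx a - 1 ∧ cy b = cy a) ∨ (cx b = cx a - 1 ∧ cy b = cy a - 1) ∨
    (cx b = cx a + 1 ∧ cy b = cy a) ∨ (cx b = cx a + 1 ∧ cy b = cy a + 1) ∨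
    (cx b = cx a ∧ cy b = cy a - 1) ∨ (cx b = cx a ∧ cy b = cy a + 1) := by
  have hne : a ≠ b ↔ ¬ (cx a = cx b ∧ cy a = cy b) := by
    constructor
    · rintro h ⟨h1, h2⟩; exact h (c_ext h1 h2)
    · rintro h rfl; exact h ⟨rfl, rfl⟩
  unfold cellAdj
  rw [hne]
  unfold InCorners cx cy
  generalize a.val.1 = r
  generalize a.val.2 = c
  generalize b.val.1 = r'
  generalize b.val.2 = c'
  constructor
  · rintro ⟨h, x, y, h1, h2⟩
    omega
  · intro h
    refine ⟨by omega, ?_⟩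
    rcases h with h | h | h | h | h | h
    · exact ⟨r, c, by omega, by omega⟩
    · exact ⟨r, c, by omega, by omega⟩
    · exact ⟨r', c', by omega, by omega⟩
    · exact ⟨r', c', by omega, by omega⟩
    · exact ⟨r + 1, c, by omega, by omega⟩
    · exact ⟨r + 1, c + 1, by omega, by omega⟩

lemma sum_adj {n : ℕ} (f : ℤ → ℤ → ℤ) (hf : ∀ x y, ¬ Cel n x y → f x y = 0) (a : CellT n) :
    (∑ b : CellT n, if cellAdj n a b then f (cx b) (cy b) else 0) = six f (cx a) (cy a) := by
  unfold six
  rw [← sum_cell f hf (cx a - 1) (cy a), ← sum_cell f hf (cx a - 1) (cy a - 1),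
    ← sum_cell f hf (cx a + 1) (cy a), ← sum_cell f hf (cx a + 1) (cy a + 1),
    ← sum_cell f hf (cx a) (cy a - 1), ← sum_cell f hf (cx a) (cy a + 1)]
  simp only [← Finset.sum_add_distrib]
  apply Finset.sum_congr rfl
  intro b _
  have := cellAdj_iff a b
  by_cases h : cellAdj n a b
  · rw [if_pos h]
    rcases this.1 h with h | h | h | h | h | h <;> split_ifs <;> omega
  · rw [if_neg h]
    rw [this] at h
    split_ifs <;> omega

lemma adj_ll {n : ℕ} (a b : CellT n) :
    (SGCgraph n).Adj (Sum.inl a) (Sum.inl b) ↔ cellAdj n a b := by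
  unfold SGCgraph
  constructor
  · rintro ⟨-, ⟨a', b', h1, h2, h⟩ | ⟨a', -, h | h⟩⟩
    · cases h1; cases h2; exact h
    · simp at h
    · simp at h
  · intro h
    exact ⟨fun he => h.1 (Sum.inl_injective he), Or.inl ⟨a, b, rfl, rfl, h⟩⟩

lemma adj_lr {n : ℕ} (a : CellT n) :
    (SGCgraph n).Adj (Sum.inl a) (Sum.inr ()) ↔ IsCornerCell n a := by
  unfold SGCgraph
  constructor
  · rintro ⟨-, ⟨a', b', h1, h2, h⟩ | ⟨a', hc, h | h⟩⟩
    · simp at h2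
    · cases h.1; exact hc
    · simp at h
  · intro h
    exact ⟨by simp, Or.inr ⟨a, h, Or.inl ⟨rfl, rfl⟩⟩⟩

lemma nsum_cell {n : ℕ} (f : ℤ → ℤ → ℤ) (hf : ∀ x y, ¬ Cel n x y → f x y = 0) (t : ℤ)
    (a : CellT n) :
    nsum (SGCgraph n) (Sum.elim (fun b => f (cx b) (cy b)) (fun _ => t)) (Sum.inl a) =
      six f (cx a) (cy a) + if IsCornerCell n a then t else 0 := by
  unfold nsum
  rw [Fintype.sum_sum_type]
  simp only [adj_ll, Sum.elim_inl, Sum.elim_inr, sum_adj f hf]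
  simp [adj_lr]

lemma corner_iff {n : ℕ} (a : CellT n) : IsCornerCell n a ↔
    (cx a = 0 ∧ cy a = 0) ∨ (cx a = 2 ^ n - 1 ∧ cy a = 0) ∨
      (cx a = 2 ^ n - 1 ∧ cy a = 2 ^ n - 1) := by
  have hp : ((2 ^ n : ℕ) : ℤ) = (2:ℤ) ^ n := by push_cast; rfl
  have hpos : 0 < 2 ^ n := by positivity
  unfold IsCornerCell cx cy
  rw [← hp]
  simp only [Prod.ext_iff]
  omega

lemma nsum_sol {n : ℕ} (hn : 0 < n) {κ t p q r : ℤ} {f : ℤ → ℤ → ℤ}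
    (h : IsSol κ n f p q r t t t) (a : CellT n) :
    nsum (SGCgraph n) (Sum.elim (fun b => f (cx b) (cy b)) (fun _ => t)) (Sum.inl a) =
      3 * f (cx a) (cy a) - κ := by
  rw [nsum_cell f h.supp, h.eq _ _ (cel_c a)]
  have h2 : (2:ℤ) ≤ 2 ^ n := by
    calc (2:ℤ) = 2 ^ 1 := by norm_num
      _ ≤ 2 ^ n := pow_le_pow_right₀ (by norm_num) hn
  have hc := corner_iff a
  by_cases hca : IsCornerCell n a
  · rw [if_pos hca]
    rcases hc.1 hca with h' | h' | h' <;> split_ifs <;> omega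
  · rw [if_neg hca]
    rw [hc] at hca
    split_ifs <;> omega

lemma deg_three {n : ℕ} (hn : 0 < n) (v : CellT n ⊕ Unit) (hv : v ∉ sinkSet n) :
    deg (SGCgraph n) v = 3 := by
  obtain ⟨a, rfl⟩ : ∃ a, v = Sum.inl a := by
    rcases v with a | u
    · exact ⟨a, rfl⟩
    · exact absurd rfl hv
  obtain ⟨f, hf, h1⟩ := exists_one n
  have := nsum_sol hn hf a
  rw [h1 _ _ (cel_c a)] at this
  have e : (Sum.elim (fun b => f (cx b) (cy b)) (fun _ => 1) : CellT n ⊕ Unit → ℤ)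
      = fun _ => 1 := by
    funext x
    rcases x with b | u
    · exact h1 _ _ (cel_c b)
    · rfl
  rw [e] at this
  unfold nsum at this
  unfold deg
  rw [Set.ncard_eq_toFinset_card']
  rw [Finset.sum_boole] at this
  have h2 : (Finset.univ.filter fun x => (SGCgraph n).Adj (Sum.inl a) x)
      = ((SGCgraph n).neighborSet (Sum.inl a)).toFinset := by
    ext x; simp
  rw [h2] at this
  have h3 : (3:ℤ) * 1 - 0 = ((3:ℕ):ℤ) := by norm_num
  rw [h3] at this
  exact Int.ofNat_inj.1 this

lemma exists_u (n : ℕ) (hn : 0 < n) : ∃ u : CellT n ⊕ Unit → ℤ, (∀ v, 0 ≤ u v) ∧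
    (∀ v ∈ sinkSet n, u v = 0) ∧ (∀ v, v ∉ sinkSet n → lap (SGCgraph n) u v = 2) ∧
    ∀ a, IsCornerCell n a → u (Sum.inl a) = 2 * 3 ^ (n - 1) := by
  obtain ⟨m, rfl⟩ : ∃ m, n = m + 1 := ⟨n - 1, by omega⟩
  obtain ⟨f, hf⟩ := exists_two m
  have hl : ∀ a : CellT (m + 1), nsum (SGCgraph (m + 1))
      (Sum.elim (fun b => f (cx b) (cy b)) (fun _ => 0)) (Sum.inl a) = 3 * f (cx a) (cy a) - 2 :=
    fun a => nsum_sol hn hf a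
  have hlap : ∀ v, v ∉ sinkSet (m + 1) → lap (SGCgraph (m + 1))
      (Sum.elim (fun b => f (cx b) (cy b)) (fun _ => 0)) v = 2 := by
    intro v hv
    unfold lap
    rw [deg_three hn v hv]
    rcases v with a | u
    · rw [hl a]; simp
    · exact absurd rfl hv
  refine ⟨_, ?_, ?_, hlap, ?_⟩
  · obtain ⟨v, -, hmin⟩ := Finset.exists_min_image (Finset.univ : Finset (CellT (m + 1) ⊕ Unit))
      (Sum.elim (fun b => f (cx b) (cy b)) (fun _ => 0)) ⟨Sum.inr (), Finset.mem_univ _⟩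
    intro x
    refine le_trans ?_ (hmin x (Finset.mem_univ x))
    by_cases hv : v ∈ sinkSet (m + 1)
    · have : v = Sum.inr () := hv
      rw [this]; simp
    · have h2 := hlap v hv
      have hd := deg_three hn v hv
      have h3 : (deg (SGCgraph (m + 1)) v : ℤ) *
          (Sum.elim (fun b => f (cx b) (cy b)) (fun _ => 0) v) ≤ nsum (SGCgraph (m + 1))
          (Sum.elim (fun b => f (cx b) (cy b)) (fun _ => 0)) v := by
        unfold nsum deg
        rw [Set.ncard_eq_toFinset_card', ← Finset.sum_filter]
        have h2 : (Finset.univ.filter fun x => (SGCgraph (m + 1)).Adj v x)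
            = ((SGCgraph (m + 1)).neighborSet v).toFinset := by
          ext x; simp
        rw [h2, ← nsmul_eq_mul]
        exact Finset.card_nsmul_le_sum _ _ _ (fun x _ => hmin x (Finset.mem_univ x))
      unfold lap at h2
      linarith
  · intro v hv
    have : v = Sum.inr () := hv
    rw [this]; simp
  · intro a ha
    rw [corner_iff] at ha
    simp only [Sum.elim_inl, Nat.add_sub_cancel]
    rcases ha with ⟨h1, h2⟩ | ⟨h1, h2⟩ | ⟨h1, h2⟩ <;> rw [h1, h2]
    · exact hf.top
    · exact hf.bl
    · exact hf.br

/-- For all levels `n > 0`, the identity element of the sandpile group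
of the level-`n` Sierpinski gasket cell graph `SGC_n` (in which each of the three
boundary cells has a single additional edge to the sink) is the configuration with
exactly `2` chips on every vertex: it is recurrent and acts as the identity on every
recurrent configuration under addition-and-stabilization.  Equivalently, the
configuration with `4` chips on every vertex stabilizes to the configuration with `2`
chips on every vertex, and in this stabilization the odometer of each boundary vertex is
`2 * 3 ^ (n - 1)`. -/
theorem sgc_identity_is_two (n : ℕ) (hn : 0 < n) :
    (Recurrent (SGCgraph n) (sinkSet n) (constConf n 2) ∧
      ∀ c : CellT n ⊕ Unit → ℕ, Recurrent (SGCgraph n) (sinkSet n) c →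
        ∃ c' : CellT n ⊕ Unit → ℕ,
          StabilizesTo (SGCgraph n) (sinkSet n) (c + constConf n 2) c' ∧
            ∀ v, v ∉ sinkSet n → c' v = c v) ∧
    (∃ (l : List (CellT n ⊕ Unit)) (η' : CellT n ⊕ Unit → ℕ),
      Topples (SGCgraph n) (sinkSet n) (constConf n 4) l η' ∧
        Stable (SGCgraph n) (sinkSet n) η' ∧
        (∀ a : CellT n, η' (Sum.inl a) = 2) ∧
        (∀ a : CellT n, IsCornerCell n a → l.count (Sum.inl a) = 2 * 3 ^ (n - 1))) := by
  obtain ⟨u, hu0, huS, hlap, hc⟩ := exists_u n hn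
  have hns : ∀ a : CellT n, (Sum.inl a : CellT n ⊕ Unit) ∉ sinkSet n := by
    intro a h
    have : (Sum.inl a : CellT n ⊕ Unit) = Sum.inr () := h
    simp at this
  have hconf : ∀ k, ∀ v, v ∉ sinkSet n → constConf n k v = k := by
    intro k v hv
    rcases v with a | u
    · rfl
    · exact absurd rfl hv
  refine ⟨core2 _ _ (deg_three hn) u hu0 huS hlap _ (hconf 2), ?_⟩
  obtain ⟨l, η', hl, hs, he, hk⟩ := core _ _ (deg_three hn) u hu0 huS hlap 1 (constConf n 4)
    (fun v hv => by rw [hconf 4 v hv])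
  refine ⟨l, η', hl, hs, fun a => he _ (hns a), fun a ha => ?_⟩
  have h1 := hk (Sum.inl a)
  rw [hc a ha] at h1
  unfold cnt at h1
  zify
  rw [Nat.cast_one, one_mul] at h1
  rw [← h1]
  congr!
  ext x y
  rw [Bool.eq_iff_iff]
  refine Iff.trans ?_ (@decide_eq_true_iff (x = y) (_)).symm
  rcases x with x | x <;> rcases y with y | y
  · exact Iff.trans (show (x == y) = true ↔ x = y from beq_iff_eq) Sum.inl_injective.eq_iff.symm
  · exact ⟨fun h => Bool.noConfusion (show false = true from h), fun h => by simp at h⟩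
  · exact ⟨fun h => Bool.noConfusion (show false = true from h), fun h => by simp at h⟩
  · exact ⟨fun _ => rfl, fun _ => rfl⟩
end
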